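/- In the p-player Zeckendorf game with two alliances and n ≥ 4pb + 2p − 2b, if alliance a contains more than two-thirds of the players, and there is a positive integer b such that for every player i not in alliance a, player (i − b) mod p is in alliance a, and alliance a contains at least 2b consecutive players, then alliance a has a winning strategy. -/

import Mathlib

/-- Fibonacci numbers indexed so that `zF 1 = 1`, `zF 2 = 2`,
`zF (i+1) = zF i + zF (i-1)`. -/
def zF (n : ℕ) : ℕ := Nat.fib (n + 1)

/-- The starting state of the Zeckendorf game on `n`: `n` copies of `F 1 = 1`.
States are multisets of indices `i`, the index `i` standing for `F i`. -/
def zstart (n : ℕ) : Multiset ℕ := Multiset.replicate n 1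

/-- Legal moves of the Zeckendorf game, on multisets of indices. -/
inductive ZMove : Multiset ℕ → Multiset ℕ → Prop
  | combine (i : ℕ) (M : Multiset ℕ) (hi : 2 ≤ i) :
      ZMove ({i - 1, i} + M) ({i + 1} + M)
  | combine1 (M : Multiset ℕ) : ZMove ({1, 1} + M) ({2} + M)
  | split2 (M : Multiset ℕ) : ZMove ({2, 2} + M) ({1, 3} + M)
  | split (i : ℕ) (M : Multiset ℕ) (hi : 3 ≤ i) :
      ZMove ({i, i} + M) ({i - 2, i + 1} + M)

/-- `ZWins p S t M` : in the `p`-player Zeckendorf game where move number `t`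
(counting from 0) is made by player `t % p`, the coalition `S` of players has a
strategy from state `M` at turn `t` guaranteeing that a member of `S` makes the
final move (the move producing a state with no legal moves). -/
inductive ZWins (p : ℕ) (S : Set ℕ) : ℕ → Multiset ℕ → Prop
  | mine_end (t : ℕ) (M M' : Multiset ℕ) (hS : t % p ∈ S) (hmv : ZMove M M')
      (h : ∀ N, ¬ ZMove M' N) : ZWins p S t M
  | mine_step (t : ℕ) (M M' : Multiset ℕ) (hS : t % p ∈ S) (hmv : ZMove M M')
      (h : ZWins p S (t + 1) M') : ZWins p S t M
  | theirs (t : ℕ) (M : Multiset ℕ) (hS : t % p ∉ S) (hne : ∃ M', ZMove M M')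
      (h : ∀ M', ZMove M M' → ZWins p S (t + 1) M') : ZWins p S t M

/-- The specific move `1 + 1 = 2`. -/
def MOneOne (M M' : Multiset ℕ) : Prop :=
  ({1, 1} : Multiset ℕ) ≤ M ∧ M' = M - {1, 1} + {2}

/-- The specific move `1 + 2 = 3`. -/
def MOneTwo (M M' : Multiset ℕ) : Prop :=
  ({1, 2} : Multiset ℕ) ≤ M ∧ M' = M - {1, 2} + {3}

/-- The specific move `2 + 2 = 1 + 3`. -/
def MTwoTwo (M M' : Multiset ℕ) : Prop :=
  ({2, 2} : Multiset ℕ) ≤ M ∧ M' = M - {2, 2} + {1, 3}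

/-- The weight of an index; its sum over a state strictly decreases along every legal move. -/
def zweight (i : ℕ) : ℕ := if i = 1 then 3 else i + 3

theorem ZMove.weight_lt {M M' : Multiset ℕ} (h : ZMove M M') :
    (M'.map zweight).sum < (M.map zweight).sum := by
  cases h with
  | combine i N hi =>
    simp only [Multiset.insert_eq_cons, Multiset.cons_add, Multiset.singleton_add,
      Multiset.map_cons, Multiset.sum_cons, zweight]
    split_ifs <;> omega
  | combine1 N =>
    simp [Multiset.insert_eq_cons, zweight]
    omega
  | split2 N =>
    simp [Multiset.insert_eq_cons, zweight]
    omega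
  | split i N hi =>
    simp only [Multiset.insert_eq_cons, Multiset.cons_add, Multiset.singleton_add,
      Multiset.map_cons, Multiset.sum_cons, zweight]
    split_ifs <;> omega

theorem ZMove.count_one_le {M M' : Multiset ℕ} (h : ZMove M M') :
    M.count 1 ≤ M'.count 1 + 2 := by
  cases h <;> simp only [Multiset.insert_eq_cons, Multiset.count_add, Multiset.count_cons,
    Multiset.count_singleton] <;> split_ifs <;> omega

theorem ZMove.count_two_le {M M' : Multiset ℕ} (h : ZMove M M') :
    M.count 2 ≤ M'.count 2 + 2 := by
  cases h <;> simp only [Multiset.insert_eq_cons, Multiset.count_add, Multiset.count_cons,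
    Multiset.count_singleton] <;> split_ifs <;> omega

theorem exists_eq_ones_add {M : Multiset ℕ} (h : 2 ≤ M.count 1) :
    ∃ N, M = {1, 1} + N := by
  have hle : ({1, 1} : Multiset ℕ) ≤ M := by
    rw [show ({1, 1} : Multiset ℕ) = Multiset.replicate 2 1 from rfl]
    exact Multiset.le_count_iff_replicate_le.mp h
  exact Multiset.le_iff_exists_add.mp hle

/-- A coalition containing every player wins from every state that has a legal move. -/
theorem ZWins.of_forall_mem {p : ℕ} {S : Set ℕ} (hS : ∀ t, t % p ∈ S) (t : ℕ) (M : Multiset ℕ)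
    (hM : ∃ M', ZMove M M') : ZWins p S t M := by
  obtain ⟨M', h⟩ := hM
  by_cases hM' : ∃ N, ZMove M' N
  · exact .mine_step t M M' (hS t) h (of_forall_mem hS (t + 1) M' hM')
  · exact .mine_end t M M' (hS t) h (not_exists.mp hM')
termination_by (M.map zweight).sum
decreasing_by exact h.weight_lt

/-- Strategy stealing: if shifting any opposing turn back by `b` gives a turn of the coalition,
then from every state with a legal move the coalition wins now or `b` turns later. -/
theorem ZWins.shift_or {p b : ℕ} {S : Set ℕ} (hS : ∀ t, (t + b) % p ∉ S → t % p ∈ S)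
    (t : ℕ) (M : Multiset ℕ) (hM : ∃ M', ZMove M M') :
    ZWins p S (t + b) M ∨ ZWins p S t M := by
  have ih : ∀ M', ZMove M M' → (∃ N, ZMove M' N) →
      ZWins p S (t + b + 1) M' ∨ ZWins p S (t + 1) M' := by
    intro M' h hM'
    have := shift_or hS (t + 1) M' hM'
    rwa [Nat.add_right_comm] at this
  by_cases hb : (t + b) % p ∈ S
  · by_contra! hnot
    have key : ∀ M', ZMove M M' → ZWins p S (t + 1) M' := by
      intro M' h
      have hM' : ∃ N, ZMove M' N := by
        by_contra hterm
        exact hnot.1 (.mine_end _ M M' hb h (not_exists.mp hterm))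
      exact (ih M' h hM').resolve_left fun hw => hnot.1 (.mine_step _ M M' hb h hw)
    by_cases ht : t % p ∈ S
    · obtain ⟨M', h⟩ := hM
      exact hnot.2 (.mine_step t M M' ht h (key M' h))
    · exact hnot.2 (.theirs t M ht hM key)
  · have ht := hS t hb
    by_cases hall : ∀ M', ZMove M M' → ZWins p S (t + b + 1) M'
    · exact .inl (.theirs _ M hb hM hall)
    · push Not at hall
      obtain ⟨M', h, hM'⟩ := hall
      right
      by_cases hne : ∃ N, ZMove M' N
      · exact .mine_step t M M' ht h ((ih M' h hne).resolve_left hM')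
      · exact .mine_end t M M' ht h (not_exists.mp hne)
termination_by (M.map zweight).sum
decreasing_by exact h.weight_lt

/-- Repeating a move `X → Y` on `k` consecutive turns of the coalition. -/
theorem ZWins.of_repeat {p : ℕ} {S : Set ℕ} {X Y : Multiset ℕ}
    (hXY : ∀ N, ZMove (X + N) (Y + N)) (k t : ℕ) (N : Multiset ℕ)
    (hS : ∀ i < k, (t + i) % p ∈ S) (h : ZWins p S (t + k) (k • Y + N)) :
    ZWins p S t (k • X + N) := by
  induction k generalizing t N with
  | zero => simpa using h
  | succ k ih =>
    refine .mine_step t _ (Y + (k • X + N)) (by simpa using hS 0 (by omega)) ?_ ?_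
    · rw [succ_nsmul', add_assoc]
      exact hXY _
    · rw [add_left_comm]
      refine ih (t + 1) (Y + N) (fun i hi => ?_) ?_
      · rw [show t + 1 + i = t + (i + 1) by omega]
        exact hS _ (by omega)
      · rw [← add_assoc, ← succ_nsmul, show t + 1 + k = t + (k + 1) by omega]
        exact h

/-- The coalition may play `1 + 1 = 2` on all of its turns among the next `d` ones. -/
theorem ZWins.of_ones {p : ℕ} {A : Finset ℕ} (d t : ℕ) (M : Multiset ℕ)
    (hM : 2 * d ≤ M.count 1)
    (h : ∀ M' : Multiset ℕ, M.count 1 ≤ M'.count 1 + 2 * d →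
      M.count 2 + 3 * ((Finset.Ico t (t + d)).filter (· % p ∈ A)).card ≤ M'.count 2 + 2 * d →
      ZWins p (↑A) (t + d) M') :
    ZWins p (↑A) t M := by
  induction d generalizing t M with
  | zero => exact h M (by simp) (by simp)
  | succ d ih =>
    have hIco : Finset.Ico t (t + (d + 1)) = insert t (Finset.Ico (t + 1) (t + 1 + d)) := by
      ext x
      simp only [Finset.mem_Ico, Finset.mem_insert]
      omega
    rw [hIco, Finset.filter_insert, show t + (d + 1) = t + 1 + d by omega] at h
    obtain ⟨N, rfl⟩ := exists_eq_ones_add (M := M) (by omega)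
    by_cases ht : t % p ∈ A
    · rw [if_pos ht, Finset.card_insert_of_notMem (by simp)] at h
      have h1 : ({1, 1} + N).count 1 = ({2} + N).count 1 + 2 := by
        simp [Multiset.insert_eq_cons]
      have h2 : ({2} + N).count 2 = ({1, 1} + N).count 2 + 1 := by
        simp [Multiset.insert_eq_cons]
      refine .mine_step t _ _ ht (.combine1 N) (ih (t + 1) _ (by omega) fun M' h1' h2' => ?_)
      exact h M' (by omega) (by omega)
    · rw [if_neg ht] at h
      refine .theirs t _ ht ⟨_, .combine1 N⟩ fun M₁ hmv => ?_
      have h1 := hmv.count_one_le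
      have h2 := hmv.count_two_le
      exact ih (t + 1) M₁ (by omega) fun M' h1' h2' => h M' (by omega) (by omega)

theorem card_filter_Ico_mod_mem {p : ℕ} {A : Finset ℕ} (hA : A ⊆ Finset.range p) (t k : ℕ) :
    ((Finset.Ico t (t + k * p)).filter (· % p ∈ A)).card = k * A.card := by
  induction k with
  | zero => simp
  | succ k ih =>
    have hper : Function.Periodic (fun x => x % p ∈ A) p := fun x => by simp
    have hone : ((Finset.Ico (t + k * p) (t + k * p + p)).filter (· % p ∈ A)).card = A.card := by
      rw [Nat.filter_Ico_card_eq_of_periodic _ _ _ hper, Nat.count_eq_card_filter_range]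
      congr 1
      ext x
      simp only [Finset.mem_filter, Finset.mem_range]
      constructor
      · rintro ⟨hx, hxA⟩
        rwa [Nat.mod_eq_of_lt hx] at hxA
      · intro hx
        have hxp := Finset.mem_range.mp (hA hx)
        exact ⟨hxp, by rwa [Nat.mod_eq_of_lt hxp]⟩
    rw [add_mul, one_mul, ← add_assoc,
      ← Finset.Ico_union_Ico_eq_Ico (Nat.le_add_right t (k * p)) (Nat.le_add_right _ p),
      Finset.filter_union, Finset.card_union_of_disjoint, ih, hone, add_mul, one_mul]
    exact Finset.disjoint_filter_filter (Finset.Ico_disjoint_Ico_consecutive _ _ _)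

/-- The stealing position: on `2 * b` consecutive turns the coalition reaches a common state
after `b` moves or after `2 * b` moves. -/
theorem ZWins.of_steal {p b : ℕ} {S : Set ℕ} (hS : ∀ t, (t + b) % p ∉ S → t % p ∈ S)
    (t : ℕ) (ht : ∀ i < 2 * b, (t + i) % p ∈ S) (M : Multiset ℕ)
    (h1 : 2 * b + 2 ≤ M.count 1) (h2 : b ≤ M.count 2) : ZWins p S t M := by
  obtain ⟨N, rfl⟩ : ∃ N, M = (b • ({1, 1} : Multiset ℕ) + b • {2} + {1, 1}) + N := by
    refine Multiset.le_iff_exists_add.mp (Multiset.le_iff_count.mpr fun a => ?_)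
    simp only [Multiset.insert_eq_cons, Multiset.count_add, Multiset.count_nsmul,
      Multiset.count_cons, Multiset.count_singleton]
    split_ifs <;> subst_vars <;> omega
  have e11 : ({1, 1} : Multiset ℕ) = {1} + {1} := rfl
  have e22 : ({2, 2} : Multiset ℕ) = {2} + {2} := rfl
  have e12 : ({1, 2} : Multiset ℕ) = {1} + {2} := rfl
  have e13 : ({1, 3} : Multiset ℕ) = {1} + {3} := rfl
  have hmove : ∃ M', ZMove (b • ({1, 3} : Multiset ℕ) + ({1, 1} + N)) M' :=
    ⟨{2} + (b • ({1, 3} : Multiset ℕ) + N), by rw [add_left_comm]; exact .combine1 _⟩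
  rcases ZWins.shift_or hS (t + b) _ hmove with hw | hw
  · have := ZWins.of_repeat .split2 b (t + b) _
      (fun i hi => by rw [add_assoc]; exact ht _ (by omega)) hw
    rw [e22, nsmul_add, add_assoc] at this
    have := ZWins.of_repeat .combine1 b t _ (fun i hi => ht i (by omega)) this
    simpa only [add_assoc] using this
  · rw [e13, nsmul_add, add_comm (b • ({1} : Multiset ℕ)), add_assoc] at hw
    have := ZWins.of_repeat (X := {1, 2}) (fun N => .combine 2 N le_rfl) b t _
      (fun i hi => ht i (by omega)) hw
    convert this using 1
    rw [e11, e12, nsmul_add, nsmul_add]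
    abel

/-- In the `p`-player two-alliance Zeckendorf game with `n ≥ 4pb + 2p - 2b`,
if alliance `A` contains more than two-thirds of the players, every player `i`
not in `A` has player `(i - b) mod p` in `A`, and `A` contains at least `2b`
consecutive players (cyclically), then `A` has a winning strategy. -/
theorem stmt_14 (p n b : ℕ) (hp : 0 < p) (hb : 0 < b)
    (hn : 4 * p * b + 2 * p - 2 * b ≤ n)
    (A : Finset ℕ) (hA : A ⊆ Finset.range p)
    (hbig : 2 * p < 3 * A.card)
    (hshift : ∀ i < p, i ∉ A → ∃ j ∈ A, (j + b) % p = i)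
    (s : ℕ) (hconsec : ∀ k < 2 * b, (s + k) % p ∈ A) :
    ZWins p (↑A) 0 (zstart n) := by
  rcases Nat.lt_or_ge p 2 with hp2 | hp2
  · obtain rfl : p = 1 := by omega
    have h0 : (0 : ℕ) ∈ A := by simpa [Nat.mod_one] using hconsec 0 (by omega)
    obtain ⟨N, hN⟩ := exists_eq_ones_add (M := zstart n) (by simp [zstart]; omega)
    exact ZWins.of_forall_mem (fun t => by simpa [Nat.mod_one] using h0) 0 _
      ⟨_, hN ▸ ZMove.combine1 N⟩
  have hshift' : ∀ t, (t + b) % p ∉ (↑A : Set ℕ) → t % p ∈ (↑A : Set ℕ) := by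
    intro t ht
    obtain ⟨j, hj, hjb⟩ := hshift _ (Nat.mod_lt _ hp) ht
    have hjt : j ≡ t [MOD p] := Nat.ModEq.add_right_cancel' b hjb
    have hjp := Finset.mem_range.mp (hA hj)
    rw [Finset.mem_coe, ← hjt, Nat.mod_eq_of_lt hjp]
    exact hj
  have hs : s % p < p := Nat.mod_lt _ hp
  have hpb : 2 * b ≤ p * b := Nat.mul_le_mul_right b hp2
  have hn' : 4 * (p * b) + 2 * p ≤ n + 2 * b := by
    rw [← mul_assoc]
    omega
  have hbp : b * p = p * b := mul_comm b p
  have hcard : b * (2 * p + 1) ≤ b * (3 * A.card) := Nat.mul_le_mul_left b hbig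
  have hcard' : 2 * (p * b) + b ≤ 3 * (b * A.card) := by linarith
  have hstart : (zstart n).count 1 = n := by simp [zstart]
  refine ZWins.of_ones (s % p) 0 _ (by omega) fun M h1 _ => ?_
  rw [zero_add]
  refine ZWins.of_ones (b * p) _ M (by omega) fun M' h1' h2' => ?_
  rw [card_filter_Ico_mod_mem hA] at h2'
  refine ZWins.of_steal hshift' _ (fun i hi => ?_) M' (by omega) (by omega)
  have : (s % p + b * p + i) % p = (s + i) % p := by
    rw [add_right_comm, Nat.add_mul_mod_self_right, Nat.mod_add_mod]
  rw [this]
  exact hconsec i hi
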